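/- arXiv:2603.16505 — 10 statements merged into one kernel-verified Lean document; each statement's English description precedes it below -/
import Mathlib

section
/- Let l̄, ū, ε be real numbers with l̄ < ū and ε > 0, let f : ℝ → ℝ, and let p(x) = a·x² + b·x + c satisfy the interpolation conditions. Then for every real x̂ with x̂ < l̄ or x̂ > ū, one has p(x̂) ≤ f(x̂) if and only if a ≤ A(x̂). -/
/-- Lemma (Bounds on a), case (a): for a parabola satisfying the interpolation
conditions, and a point x̂ outside [l̄, ū], p(x̂) ≤ f(x̂) iff a ≤ A(x̂). -/
theorem parabola_outside_iff_le_A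
    (lb ub ε a b c : ℝ) (f : ℝ → ℝ)
    (hlu : lb < ub) (hε : 0 < ε)
    (hlo : a * lb ^ 2 + b * lb + c = f lb - ε)
    (hup : a * ub ^ 2 + b * ub + c = f ub - ε)
    (x : ℝ) (hx : x < lb ∨ ub < x) :
    a * x ^ 2 + b * x + c ≤ f x ↔
      a ≤ (f x - f lb + ε) / ((x - lb) * (x - ub))
          - (f ub - f lb) / ((ub - lb) * (x - ub)) := by
  have hpos : 0 < (x - lb) * (x - ub) := by
    rcases hx with hx | hx
    · exact mul_pos_of_neg_of_neg (by linarith) (by linarith)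
    · exact mul_pos (by linarith) (by linarith)
  have hxl : x - lb ≠ 0 := left_ne_zero_of_mul hpos.ne'
  have hxu : x - ub ≠ 0 := right_ne_zero_of_mul hpos.ne'
  have hul : ub - lb ≠ 0 := (sub_pos.2 hlu).ne'
  have hsub : (f x - f lb + ε) / ((x - lb) * (x - ub))
      - (f ub - f lb) / ((ub - lb) * (x - ub)) - a
      = (f x - (a * x ^ 2 + b * x + c)) / ((x - lb) * (x - ub)) := by
    have hl : f lb = a * lb ^ 2 + b * lb + c + ε := by linarith
    have hu : f ub = a * ub ^ 2 + b * ub + c + ε := by linarith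
    rw [hl, hu]
    field_simp
    ring
  rw [← sub_nonneg, ← sub_nonneg (b := a), hsub, le_div_iff₀ hpos, zero_mul]
end

section
/- Let l̄, ū, ε be real numbers with l̄ < ū and ε > 0, let f : ℝ → ℝ, and let p(x) = a·x² + b·x + c satisfy the interpolation conditions. Then for every real x̂ with l̄ < x̂ < ū, one has p(x̂) ≤ f(x̂) if and only if a ≥ A(x̂). -/
/-- Lemma (Bounds on a), case (b): for a parabola satisfying the interpolation
conditions, and a point x̂ in the interior of [l̄, ū], p(x̂) ≤ f(x̂) iff a ≥ A(x̂). -/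
theorem parabola_inside_iff_ge_A
    (lb ub ε a b c : ℝ) (f : ℝ → ℝ)
    (hlu : lb < ub) (hε : 0 < ε)
    (hlo : a * lb ^ 2 + b * lb + c = f lb - ε)
    (hup : a * ub ^ 2 + b * ub + c = f ub - ε)
    (x : ℝ) (hx1 : lb < x) (hx2 : x < ub) :
    a * x ^ 2 + b * x + c ≤ f x ↔
      a ≥ (f x - f lb + ε) / ((x - lb) * (x - ub))
          - (f ub - f lb) / ((ub - lb) * (x - ub)) := by
  have hl : x - lb ≠ 0 := (sub_pos.2 hx1).ne'
  have hu : x - ub ≠ 0 := (sub_neg.2 hx2).ne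
  have hd : ub - lb ≠ 0 := (sub_pos.2 hlu).ne'
  have hslope : f ub - f lb = (a * (ub + lb) + b) * (ub - lb) := by
    linear_combination hlo - hup
  have hA : (f x - f lb + ε) / ((x - lb) * (x - ub)) - (f ub - f lb) / ((ub - lb) * (x - ub))
      = a + (f x - (a * x ^ 2 + b * x + c)) / ((x - lb) * (x - ub)) := by
    rw [hslope]
    field_simp
    linear_combination hlo
  have hneg : (x - lb) * (x - ub) < 0 := mul_neg_of_pos_of_neg (sub_pos.2 hx1) (sub_neg.2 hx2)
  rw [hA, ge_iff_le, add_le_iff_nonpos_right, div_le_iff_of_neg hneg, zero_mul, sub_nonneg]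
end

section
/- Let l̄, ū, ε be real numbers with l̄ < ū and ε > 0, let f : ℝ → ℝ, and let p(x) = a·x² + b·x + c satisfy the interpolation conditions. Then for every real x̂ with l̄ < x̂ < ū, one has p(x̂) ≥ f(x̂) − ε if and only if a ≤ B(x̂). -/
/-- Lemma (Bounds on a), case (c): for a parabola satisfying the interpolation
conditions, and a point x̂ in the interior of [l̄, ū], p(x̂) ≥ f(x̂) − ε iff a ≤ B(x̂). -/
theorem parabola_inside_eps_iff_le_B
    (lb ub ε a b c : ℝ) (f : ℝ → ℝ)
    (hlu : lb < ub) (hε : 0 < ε)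
    (hlo : a * lb ^ 2 + b * lb + c = f lb - ε)
    (hup : a * ub ^ 2 + b * ub + c = f ub - ε)
    (x : ℝ) (hx1 : lb < x) (hx2 : x < ub) :
    a * x ^ 2 + b * x + c ≥ f x - ε ↔
      a ≤ (f x - f lb) / ((x - lb) * (x - ub))
          - (f ub - f lb) / ((ub - lb) * (x - ub)) := by
  have h_lb : x - lb ≠ 0 := (sub_pos.2 hx1).ne'
  have h_ub : x - ub ≠ 0 := (sub_neg.2 hx2).ne
  have h_ul : ub - lb ≠ 0 := (sub_pos.2 hlu).ne'
  have h_neg : (x - lb) * (x - ub) < 0 :=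
    mul_neg_of_pos_of_neg (sub_pos.2 hx1) (sub_neg.2 hx2)
  have h_flb : f lb = a * lb ^ 2 + b * lb + c + ε := by linarith
  have h_fub : f ub = a * ub ^ 2 + b * ub + c + ε := by linarith
  have key : (f x - f lb) / ((x - lb) * (x - ub)) - (f ub - f lb) / ((ub - lb) * (x - ub)) - a
      = (f x - ε - (a * x ^ 2 + b * x + c)) / ((x - lb) * (x - ub)) := by
    rw [h_flb, h_fub]
    field_simp
    ring
  rw [ge_iff_le, ← sub_nonneg (b := a), key, le_div_iff_of_neg h_neg, zero_mul, sub_nonpos]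
end

section
/- Let l̄, ū, ε be real numbers with l̄ < ū and ε > 0, and let f : ℝ → ℝ be differentiable at l̄ with derivative f'(l̄). Then B(x) tends to (f(ū) − f(l̄) + (l̄ − ū)·f'(l̄))/(ū − l̄)² as x tends to l̄ from the right within the open interval (l̄, ū). -/
/-- Limit of B(x) as x → l̄ from the right within (l̄, ū). -/
theorem B_limit_at_lb
    (lb ub ε f' : ℝ) (f : ℝ → ℝ)
    (hlu : lb < ub) (hε : 0 < ε)
    (hf : HasDerivAt f f' lb) :
    Filter.Tendsto
      (fun x : ℝ =>
        (f x - f lb) / ((x - lb) * (x - ub)) - (f ub - f lb) / ((ub - lb) * (x - ub)))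
      (nhdsWithin lb (Set.Ioo lb ub))
      (nhds ((f ub - f lb + (lb - ub) * f') / (ub - lb) ^ 2)) := by
  have hne : lb - ub ≠ 0 := (sub_neg.mpr hlu).ne
  have hne' : ub - lb ≠ 0 := (sub_pos.mpr hlu).ne'
  have hslope : Filter.Tendsto (slope f lb) (nhdsWithin lb (Set.Ioo lb ub)) (nhds f') :=
    (hasDerivAt_iff_tendsto_slope.mp hf).mono_left
      (nhdsWithin_mono _ fun _ hx => ne_of_gt hx.1)
  have hsub : Filter.Tendsto (fun x : ℝ => x - ub) (nhdsWithin lb (Set.Ioo lb ub))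
      (nhds (lb - ub)) :=
    ((continuous_id.sub continuous_const).tendsto lb).mono_left nhdsWithin_le_nhds
  have key := (hslope.div hsub hne).sub
    ((tendsto_const_nhds (x := f ub - f lb)).div (hsub.const_mul (ub - lb))
      (mul_ne_zero hne' hne))
  have hlim : f' / (lb - ub) - (f ub - f lb) / ((ub - lb) * (lb - ub))
      = (f ub - f lb + (lb - ub) * f') / (ub - lb) ^ 2 := by
    rw [← neg_sub ub lb]
    field_simp
    ring
  rw [← hlim]
  refine key.congr fun x => ?_
  simp only [Pi.div_apply, slope_def_field, div_div]
end

section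
/- Let l̄, ū, ε be real numbers with l̄ < ū and ε > 0, and let f : ℝ → ℝ be differentiable at ū with derivative f'(ū). Then B(x) tends to (f(l̄) − f(ū) + (ū − l̄)·f'(ū))/(ū − l̄)² as x tends to ū from the left within the open interval (l̄, ū). -/
/-- Limit of B(x) as x → ū from the left within (l̄, ū). -/
theorem B_limit_at_ub
    (lb ub ε f' : ℝ) (f : ℝ → ℝ)
    (hlu : lb < ub) (hε : 0 < ε)
    (hf : HasDerivAt f f' ub) :
    Filter.Tendsto
      (fun x : ℝ =>
        (f x - f lb) / ((x - lb) * (x - ub)) - (f ub - f lb) / ((ub - lb) * (x - ub)))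
      (nhdsWithin ub (Set.Ioo lb ub))
      (nhds ((f lb - f ub + (ub - lb) * f') / (ub - lb) ^ 2)) := by
  have hne : ub - lb ≠ 0 := sub_ne_zero.mpr hlu.ne'
  have hslope : Filter.Tendsto (slope f ub) (nhdsWithin ub (Set.Ioo lb ub)) (nhds f') :=
    hf.tendsto_slope.mono_left (nhdsWithin_mono _ fun _ hx => hx.2.ne)
  have hid : Filter.Tendsto (fun x : ℝ => x) (nhdsWithin ub (Set.Ioo lb ub)) (nhds ub) :=
    nhdsWithin_le_nhds
  have hlim := ((hslope.const_mul (ub - lb)).const_add (f lb - f ub)).div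
    ((hid.sub_const lb).mul_const (ub - lb)) (mul_ne_zero hne hne)
  rw [← sq] at hlim
  refine hlim.congr' ?_
  filter_upwards [self_mem_nhdsWithin] with x hx
  have hxl : x - lb ≠ 0 := sub_ne_zero.mpr hx.1.ne'
  have hxu : x - ub ≠ 0 := sub_ne_zero.mpr hx.2.ne
  simp only [Pi.div_apply, slope_def_field]
  field_simp
  ring
end

section
/- Let x̲, x̄, l̄, ū, ε be real numbers with x̲ < l̄ < ū < x̄ and ε > 0, and let f : ℝ → ℝ. For every a ∈ ℝ, the parameterized parabola p(·; a) satisfies both p(x; a) ≤ f(x) for all x ∈ [x̲, x̄] and p(x; a) ≥ f(x) − ε for all x ∈ [l̄, ū] if and only if: A(x̂) ≤ a and a ≤ B(x̂) for all x̂ with l̄ < x̂ < ū, and a ≤ A(x̂) for all x̂ ∈ [x̲, x̄] with x̂ < l̄ or x̂ > ū. -/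
theorem div_sub_secant_div_eq {l u x : ℝ} (c s : ℝ) (hlu : u - l ≠ 0) (hl : x - l ≠ 0)
    (hu : x - u ≠ 0) :
    c / ((x - l) * (x - u)) - s / ((u - l) * (x - u)) =
      (c - (x - l) * s / (u - l)) / ((x - l) * (x - u)) := by
  field_simp

/-- The parameterized parabola p(·; a) is a global underestimator on [x̲, x̄] and an
ε-approximation on [l̄, ū] iff a lies between the bounds induced by A and B. -/
theorem parameterized_parabola_feasibility_iff
    (xlo xhi lb ub ε a : ℝ) (f : ℝ → ℝ)
    (h1 : xlo < lb) (h2 : lb < ub) (h3 : ub < xhi) (hε : 0 < ε) :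
    ((∀ x ∈ Set.Icc xlo xhi,
        a * (x - lb) * (x - ub) + (x - lb) * (f ub - f lb) / (ub - lb) + f lb - ε ≤ f x) ∧
     (∀ x ∈ Set.Icc lb ub,
        a * (x - lb) * (x - ub) + (x - lb) * (f ub - f lb) / (ub - lb) + f lb - ε ≥ f x - ε))
    ↔
    ((∀ x : ℝ, lb < x → x < ub →
        (f x - f lb + ε) / ((x - lb) * (x - ub))
          - (f ub - f lb) / ((ub - lb) * (x - ub)) ≤ a ∧
        a ≤ (f x - f lb) / ((x - lb) * (x - ub))
          - (f ub - f lb) / ((ub - lb) * (x - ub))) ∧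
     (∀ x ∈ Set.Icc xlo xhi, (x < lb ∨ ub < x) →
        a ≤ (f x - f lb + ε) / ((x - lb) * (x - ub))
          - (f ub - f lb) / ((ub - lb) * (x - ub)))) := by
  have hlu : ub - lb ≠ 0 := (sub_pos.2 h2).ne'
  have secant_ub : (ub - lb) * (f ub - f lb) / (ub - lb) = f ub - f lb :=
    mul_div_cancel_left₀ _ hlu
  constructor
  · rintro ⟨under, approx⟩
    refine ⟨fun x hl hu => ?_, fun x hx hout => ?_⟩
    · have hneg : (x - lb) * (x - ub) < 0 := mul_neg_of_pos_of_neg (sub_pos.2 hl) (sub_neg.2 hu)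
      have hle := under x ⟨by linarith, by linarith⟩
      have hge := approx x ⟨hl.le, hu.le⟩
      rw [div_sub_secant_div_eq _ _ hlu (sub_pos.2 hl).ne' (sub_neg.2 hu).ne,
        div_sub_secant_div_eq _ _ hlu (sub_pos.2 hl).ne' (sub_neg.2 hu).ne,
        div_le_iff_of_neg hneg, le_div_iff_of_neg hneg]
      constructor <;> linarith
    · have hpos : 0 < (x - lb) * (x - ub) := by
        rcases hout with h | h
        · exact mul_pos_of_neg_of_neg (by linarith) (by linarith)
        · exact mul_pos (by linarith) (by linarith)
      have hle := under x hx
      rw [div_sub_secant_div_eq _ _ hlu (left_ne_zero_of_mul hpos.ne')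
        (right_ne_zero_of_mul hpos.ne'), le_div_iff₀ hpos]
      linarith
  · rintro ⟨inner, outer⟩
    have inside : ∀ x, lb < x → x < ub →
        a * (x - lb) * (x - ub) + (x - lb) * (f ub - f lb) / (ub - lb) + f lb - ε ≤ f x ∧
        a * (x - lb) * (x - ub) + (x - lb) * (f ub - f lb) / (ub - lb) + f lb - ε ≥ f x - ε := by
      intro x hl hu
      have hneg : (x - lb) * (x - ub) < 0 := mul_neg_of_pos_of_neg (sub_pos.2 hl) (sub_neg.2 hu)
      have hab := inner x hl hu
      rw [div_sub_secant_div_eq _ _ hlu (sub_pos.2 hl).ne' (sub_neg.2 hu).ne,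
        div_sub_secant_div_eq _ _ hlu (sub_pos.2 hl).ne' (sub_neg.2 hu).ne,
        div_le_iff_of_neg hneg, le_div_iff_of_neg hneg] at hab
      constructor <;> linarith [hab.1, hab.2]
    have outside : ∀ x ∈ Set.Icc xlo xhi, (x < lb ∨ ub < x) →
        a * (x - lb) * (x - ub) + (x - lb) * (f ub - f lb) / (ub - lb) + f lb - ε ≤ f x := by
      intro x hx hout
      have hpos : 0 < (x - lb) * (x - ub) := by
        rcases hout with h | h
        · exact mul_pos_of_neg_of_neg (by linarith) (by linarith)
        · exact mul_pos (by linarith) (by linarith)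
      have ha := outer x hx hout
      rw [div_sub_secant_div_eq _ _ hlu (left_ne_zero_of_mul hpos.ne')
        (right_ne_zero_of_mul hpos.ne'), le_div_iff₀ hpos] at ha
      linarith
    constructor
    · intro x hx
      rcases lt_trichotomy x lb with h | rfl | hl
      · exact outside x hx (Or.inl h)
      · simp [hε.le]
      · rcases lt_trichotomy x ub with hu | rfl | h
        · exact (inside x hl hu).1
        · rw [secant_ub]
          linarith
        · exact outside x hx (Or.inr h)
    · rintro x ⟨hlx, hxu⟩
      rcases hlx.eq_or_lt with rfl | hl
      · simp
      · rcases hxu.eq_or_lt with rfl | hu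
        · rw [secant_ub]
          linarith
        · exact (inside x hl hu).2
end

section
/- Let l̄, ū, ε, L be real numbers with l̄ < ū, ε > 0 and L > 0, set Δ = ū − l̄, and let f : ℝ → ℝ be L-Lipschitz on [l̄, ū]. Then for every x̂ with l̄ < x̂ < ū, B(x̂) ≥ −4·L/Δ; consequently the parameterized parabola with quadratic coefficient a = −4·L/Δ satisfies p(x; a) ≥ f(x) − ε for all x ∈ [l̄, ū]. -/
/-- The deviation of an `L`-Lipschitz function from its chord, scaled by the length of the
interval, is at most `2 * L * (x - a) * (b - x)`. -/
theorem lipschitz_sub_chord_le {a b L x : ℝ} {f : ℝ → ℝ} (hx : x ∈ Set.Icc a b)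
    (hLip : ∀ x ∈ Set.Icc a b, ∀ y ∈ Set.Icc a b, |f x - f y| ≤ L * |x - y|) :
    (f x - f a) * (b - a) - (f b - f a) * (x - a) ≤ 2 * L * ((x - a) * (b - x)) := by
  have hab : a ≤ b := hx.1.trans hx.2
  have ha := (le_abs_self _).trans (hLip x hx a (Set.left_mem_Icc.2 hab))
  have hb := (le_abs_self _).trans (hLip x hx b (Set.right_mem_Icc.2 hab))
  rw [abs_of_nonneg (sub_nonneg.2 hx.1)] at ha
  rw [abs_of_nonpos (sub_nonpos.2 hx.2)] at hb
  have h₁ := mul_le_mul_of_nonneg_right ha (sub_nonneg.2 hx.2)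
  have h₂ := mul_le_mul_of_nonneg_right hb (sub_nonneg.2 hx.1)
  linarith

/-- For an L-Lipschitz function on [l̄, ū], B(x̂) ≥ −4L/Δ on the interior, and hence
the parameterized parabola with a = −4L/Δ is an ε-approximation on [l̄, ū]. -/
theorem B_lower_bound_and_eps_approx
    (lb ub ε L Δ : ℝ) (f : ℝ → ℝ)
    (hlu : lb < ub) (hε : 0 < ε) (hL : 0 < L)
    (hΔ : Δ = ub - lb)
    (hLip : ∀ x ∈ Set.Icc lb ub, ∀ y ∈ Set.Icc lb ub, |f x - f y| ≤ L * |x - y|) :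
    (∀ x : ℝ, lb < x → x < ub →
      (f x - f lb) / ((x - lb) * (x - ub))
        - (f ub - f lb) / ((ub - lb) * (x - ub)) ≥ -4 * L / Δ) ∧
    (∀ x ∈ Set.Icc lb ub,
      (-4 * L / Δ) * (x - lb) * (x - ub) + (x - lb) * (f ub - f lb) / (ub - lb)
        + f lb - ε ≥ f x - ε) := by
  subst hΔ
  have hD : 0 < ub - lb := sub_pos.2 hlu
  have key : ∀ x ∈ Set.Icc lb ub,
      0 ≤ 4 * L * ((x - lb) * (ub - x))
        - ((f x - f lb) * (ub - lb) - (f ub - f lb) * (x - lb)) := fun x hx => by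
    have h := lipschitz_sub_chord_le hx hLip
    have hpos : 0 ≤ L * ((x - lb) * (ub - x)) :=
      mul_nonneg hL.le (mul_nonneg (sub_nonneg.2 hx.1) (sub_nonneg.2 hx.2))
    linarith
  constructor
  · intro x hl hu
    have hs : 0 < x - lb := sub_pos.2 hl
    have ht : 0 < ub - x := sub_pos.2 hu
    have hxu : x - ub ≠ 0 := (sub_neg.2 hu).ne
    refine sub_nonneg.1 ((div_nonneg (key x ⟨hl.le, hu.le⟩)
      (mul_pos (mul_pos hs ht) hD).le).trans_eq ?_)
    field_simp
    ring
  · intro x hx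
    refine sub_nonneg.1 ((div_nonneg (key x hx) hD.le).trans_eq ?_)
    field_simp
    ring
end

section
/- Let l̄, ū, ε, L be real numbers with l̄ < ū, ε > 0 and L > 0, set Δ = ū − l̄, assume 3·L·Δ ≤ ε, and let f : ℝ → ℝ be L-Lipschitz on [l̄, ū]. Then the parameterized parabola with quadratic coefficient a = −4·L/Δ satisfies p(x; a) ≤ f(x) for all x ∈ [l̄, ū]. -/
/-- For an L-Lipschitz function on [l̄, ū] with 3LΔ ≤ ε, the parameterized parabola
with a = −4L/Δ underestimates f on [l̄, ū]. -/
theorem parabola_underestimates_inside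
    (lb ub ε L Δ : ℝ) (f : ℝ → ℝ)
    (hlu : lb < ub) (hε : 0 < ε) (hL : 0 < L)
    (hΔ : Δ = ub - lb) (hΔε : 3 * L * Δ ≤ ε)
    (hLip : ∀ x ∈ Set.Icc lb ub, ∀ y ∈ Set.Icc lb ub, |f x - f y| ≤ L * |x - y|) :
    ∀ x ∈ Set.Icc lb ub,
      (-4 * L / Δ) * (x - lb) * (x - ub) + (x - lb) * (f ub - f lb) / (ub - lb)
        + f lb - ε ≤ f x := by
  subst hΔ
  intro x hx
  have hpos : 0 < ub - lb := sub_pos.2 hlu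
  have hs : 0 ≤ x - lb := sub_nonneg.2 hx.1
  have hquad : -4 * L / (ub - lb) * (x - lb) * (x - ub) ≤ L * (ub - lb) := by
    rw [mul_assoc, div_mul_eq_mul_div, div_le_iff₀ hpos]
    nlinarith [mul_nonneg hL.le (sq_nonneg (2 * x - lb - ub))]
  have hends : f ub - f lb ≤ L * (ub - lb) := by
    have h := hLip ub (Set.right_mem_Icc.2 hlu.le) lb (Set.left_mem_Icc.2 hlu.le)
    rw [abs_of_pos hpos] at h
    exact (le_abs_self _).trans h
  have hlin : (x - lb) * (f ub - f lb) / (ub - lb) ≤ L * (x - lb) := by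
    rw [div_le_iff₀ hpos]
    linarith [mul_le_mul_of_nonneg_left hends hs]
  have hleft : f lb - f x ≤ L * (x - lb) := by
    have h := hLip x hx lb (Set.left_mem_Icc.2 hlu.le)
    rw [abs_of_nonneg hs] at h
    linarith [neg_le_abs (f x - f lb)]
  have hright : L * (x - lb) ≤ L * (ub - lb) :=
    mul_le_mul_of_nonneg_left (sub_le_sub_right hx.2 lb) hL.le
  linarith
end

section
/- Let x̲, x̄, l̄, ū, ε, L be real numbers with x̲ ≤ l̄ < ū ≤ x̄, ε > 0 and L > 0, set Δ = ū − l̄, and let f : ℝ → ℝ be L-Lipschitz on [x̲, x̄]. Then the parameterized parabola with quadratic coefficient a = −4·L/Δ satisfies p(x; a) ≤ f(x) for every x ∈ [x̲, x̄] with x ≤ l̄ or x ≥ ū. -/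
/-- For an L-Lipschitz function on [x̲, x̄], the parameterized parabola with
a = −4L/Δ underestimates f outside (l̄, ū). -/
theorem parabola_underestimates_outside
    (xlo xhi lb ub ε L Δ : ℝ) (f : ℝ → ℝ)
    (h1 : xlo ≤ lb) (h2 : lb < ub) (h3 : ub ≤ xhi) (hε : 0 < ε) (hL : 0 < L)
    (hΔ : Δ = ub - lb)
    (hLip : ∀ x ∈ Set.Icc xlo xhi, ∀ y ∈ Set.Icc xlo xhi, |f x - f y| ≤ L * |x - y|) :
    ∀ x ∈ Set.Icc xlo xhi, (x ≤ lb ∨ ub ≤ x) →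
      (-4 * L / Δ) * (x - lb) * (x - ub) + (x - lb) * (f ub - f lb) / (ub - lb)
        + f lb - ε ≤ f x := by
  intro x hx hout
  subst hΔ
  have hD : 0 < ub - lb := sub_pos.2 h2
  have hlb : lb ∈ Set.Icc xlo xhi := ⟨h1, h2.le.trans h3⟩
  have hub : ub ∈ Set.Icc xlo xhi := ⟨h1.trans h2.le, h3⟩
  obtain ⟨s, hs⟩ : ∃ s, s = (f ub - f lb) / (ub - lb) := ⟨_, rfl⟩
  obtain ⟨k, hk⟩ : ∃ k, k = L / (ub - lb) := ⟨_, rfl⟩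
  have hsD : s * (ub - lb) = f ub - f lb := by rw [hs, div_mul_cancel₀ _ hD.ne']
  have hkD : k * (ub - lb) = L := by rw [hk, div_mul_cancel₀ _ hD.ne']
  have hk0 : 0 < k := hk ▸ div_pos hL hD
  have hsL : |s| ≤ L := by
    have h := hLip ub hub lb hlb
    rw [abs_of_pos hD] at h
    rwa [hs, abs_div, abs_of_pos hD, div_le_iff₀ hD]
  obtain ⟨hs1, hs2⟩ := abs_le.1 hsL
  rw [mul_div_assoc (x - lb), ← hs, mul_div_assoc (-4), ← hk]
  rcases hout with hxl | hxu
  · have h := (abs_le.1 (hLip x hx lb hlb)).1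
    rw [abs_of_nonpos (sub_nonpos.2 hxl)] at h
    have ht : 0 ≤ lb - x := sub_nonneg.2 hxl
    have hquad : -4 * k * (x - lb) * (x - ub)
        = -4 * (k * (lb - x) ^ 2) - 4 * (L * (lb - x)) := by
      rw [← hkD]; ring
    have hkt : 0 ≤ k * (lb - x) ^ 2 := by positivity
    have hLt : 0 ≤ L * (lb - x) := by positivity
    have hst := mul_le_mul_of_nonneg_right hs1 ht
    linarith
  · have h := (abs_le.1 (hLip x hx ub hub)).1
    rw [abs_of_nonneg (sub_nonneg.2 hxu)] at h
    have ht : 0 ≤ x - ub := sub_nonneg.2 hxu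
    have hquad : -4 * k * (x - lb) * (x - ub)
        = -4 * (k * (x - ub) ^ 2) - 4 * (L * (x - ub)) := by
      rw [← hkD]; ring
    have hkt : 0 ≤ k * (x - ub) ^ 2 := by positivity
    have hLt : 0 ≤ L * (x - ub) := by positivity
    have hst := mul_le_mul_of_nonneg_right hs2 ht
    linarith
end

section
/- Let x̲, x̄, ε, L be real numbers with x̲ < x̄, ε > 0 and L > 0, let f : ℝ → ℝ be L-Lipschitz on D = [x̲, x̄], let Δ > 0 satisfy Δ ≤ ε/(3·L), and suppose (x̄ − x̲)/Δ is a positive natural number K. Then for every k ∈ {1, …, K} there exist real numbers b_k and c_k such that the parabola p_k(x) = −(4·L/Δ)·x² + b_k·x + c_k satisfies f(x) − ε ≤ p_k(x) for all x in the subinterval [x̲ + (k−1)·Δ, x̲ + k·Δ] and p_k(x) ≤ f(x) for all x ∈ D. -/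
/-- Correctness of the outer loop: for an L-Lipschitz function on D = [x̲, x̄] and a
partition of D into K subintervals of length Δ ≤ ε/(3L), on each subinterval there is
a parabola with quadratic coefficient −4L/Δ which is an ε-approximation of f on the
subinterval and a global underestimator of f on D. -/
theorem outer_loop_correctness
    (xlo xhi ε L Δ : ℝ) (f : ℝ → ℝ) (K : ℕ)
    (hx : xlo < xhi) (hε : 0 < ε) (hL : 0 < L)
    (hLip : ∀ x ∈ Set.Icc xlo xhi, ∀ y ∈ Set.Icc xlo xhi, |f x - f y| ≤ L * |x - y|)
    (hΔ : 0 < Δ) (hΔε : Δ ≤ ε / (3 * L))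
    (hK : 0 < K) (hKΔ : (xhi - xlo) / Δ = (K : ℝ)) :
    ∀ k : ℕ, 1 ≤ k → k ≤ K → ∃ b c : ℝ,
      (∀ x ∈ Set.Icc (xlo + ((k : ℝ) - 1) * Δ) (xlo + (k : ℝ) * Δ),
        f x - ε ≤ -(4 * L / Δ) * x ^ 2 + b * x + c) ∧
      (∀ x ∈ Set.Icc xlo xhi, -(4 * L / Δ) * x ^ 2 + b * x + c ≤ f x) := by
  intro k hk1 hkK
  have hk1' : (1 : ℝ) ≤ k := by exact_mod_cast hk1
  have hkK' : (k : ℝ) ≤ K := by exact_mod_cast hkK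
  have hxhi : xhi = xlo + K * Δ := by
    rw [div_eq_iff hΔ.ne'] at hKΔ
    linarith
  have hε' : 3 * (L * Δ) ≤ ε := by
    rw [le_div_iff₀ (by positivity)] at hΔε
    linarith
  have hkΔ : 1 * Δ ≤ k * Δ := by gcongr
  have hKkΔ : k * Δ ≤ K * Δ := by gcongr
  -- the parabola has its vertex above the midpoint `m` of the subinterval, at height `f m - L * Δ`
  obtain ⟨m, hm⟩ : ∃ m, m = xlo + k * Δ - Δ / 2 := ⟨_, rfl⟩
  have hmD : m ∈ Set.Icc xlo xhi := ⟨by linarith, by linarith⟩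
  obtain ⟨r, hr⟩ : ∃ r, r = L / Δ := ⟨_, rfl⟩
  have hr0 : 0 < r := hr ▸ div_pos hL hΔ
  have hLr : L = r * Δ := by rw [hr, div_mul_cancel₀ _ hΔ.ne']
  have hvertex : ∀ x, -(4 * L / Δ) * x ^ 2 + 8 * r * m * x + (f m - L * Δ - 4 * r * m ^ 2) =
      f m - L * Δ - 4 * r * |x - m| ^ 2 := by
    intro x
    rw [sq_abs, mul_div_assoc, ← hr]
    ring
  refine ⟨8 * r * m, f m - L * Δ - 4 * r * m ^ 2, fun x hxk => ?_, fun x hxD => ?_⟩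
  · have hxD : x ∈ Set.Icc xlo xhi := ⟨by linarith [hxk.1], by linarith [hxk.2]⟩
    have hf := (abs_le.mp (hLip x hxD m hmD)).2
    have ht : |x - m| ≤ Δ / 2 := abs_le.mpr ⟨by linarith [hxk.1], by linarith [hxk.2]⟩
    have hLt : L * |x - m| ≤ L * (Δ / 2) := by gcongr
    have hrt : r * |x - m| ^ 2 ≤ r * (Δ / 2) ^ 2 := by gcongr
    have hrΔ : r * (Δ / 2) ^ 2 = L * Δ / 4 := by rw [hLr]; ring
    have hLΔ : 0 < L * Δ := mul_pos hL hΔ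
    rw [hvertex]
    linarith
  · have hf := (abs_le.mp (hLip x hxD m hmD)).1
    have hsq : 0 ≤ r * (Δ ^ 2 - Δ * |x - m| + 4 * |x - m| ^ 2) :=
      mul_nonneg hr0.le (by nlinarith [sq_nonneg (Δ / 2 - |x - m|)])
    have hexp : r * (Δ ^ 2 - Δ * |x - m| + 4 * |x - m| ^ 2) =
        L * Δ - L * |x - m| + 4 * r * |x - m| ^ 2 := by
      rw [hLr]; ring
    rw [hvertex]
    linarith
end
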